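/- Let E ⊂ ℝ^n be nonempty and bounded and let d(s) be the lower (or upper) s-box dimension profile of E. If 0 < s ≤ t and d(s) > 0, then d(t) − d(s) ≤ (d(s)d(t)/(st))(t − s) ≤ t − s; in particular s ↦ d(s) is Lipschitz with constant 1 on intervals where it is positive. -/

import Mathlib

open MeasureTheory Metric Classical Filter

/-- The kernel φ_r^s(x) = min{1, (r/|x|)^s}, with value 1 at x = 0. -/
noncomputable def phiKer (n : ℕ) (s r : ℝ) (x : EuclideanSpace ℝ (Fin n)) : ℝ :=
  if x = 0 then 1 else min 1 ((r / ‖x‖) ^ s)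

/-- N_r(E): the minimal number of sets of diameter at most r needed to cover E. -/
noncomputable def coverNum {X : Type*} [PseudoMetricSpace X] (E : Set X) (r : ℝ) : ℕ :=
  sInf {k | ∃ S : Finset (Set X), S.card = k ∧ (∀ A ∈ S, Metric.diam A ≤ r) ∧ E ⊆ ⋃₀ ↑S}

/-- The capacity C_r^s(E): reciprocal of the infimal energy over probability
measures supported on the closure of E. -/
noncomputable def capacity (n : ℕ) (s r : ℝ) (E : Set (EuclideanSpace ℝ (Fin n))) : ℝ :=
  (sInf {I : ℝ | ∃ μ : Measure (EuclideanSpace ℝ (Fin n)),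
    IsProbabilityMeasure μ ∧ μ (closure E)ᶜ = 0 ∧
      I = ∫ x, ∫ y, phiKer n s r (x - y) ∂μ ∂μ})⁻¹

/-- The lower s-box dimension profile of E. -/
noncomputable def lowerProfile (n : ℕ) (s : ℝ) (E : Set (EuclideanSpace ℝ (Fin n))) : ℝ :=
  liminf (fun r => Real.log (capacity n s r E) / (-Real.log r)) (nhdsWithin 0 (Set.Ioi 0))

/-- The upper s-box dimension profile of E. -/
noncomputable def upperProfile (n : ℕ) (s : ℝ) (E : Set (EuclideanSpace ℝ (Fin n))) : ℝ :=
  limsup (fun r => Real.log (capacity n s r E) / (-Real.log r)) (nhdsWithin 0 (Set.Ioi 0))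

/-- The lower box dimension of a bounded set, via covering numbers. -/
noncomputable def lowerBoxDim {X : Type*} [PseudoMetricSpace X] (E : Set X) : ℝ :=
  liminf (fun r => Real.log (coverNum E r) / (-Real.log r)) (nhdsWithin 0 (Set.Ioi 0))

/-- The upper box dimension of a bounded set, via covering numbers. -/
noncomputable def upperBoxDim {X : Type*} [PseudoMetricSpace X] (E : Set X) : ℝ :=
  limsup (fun r => Real.log (coverNum E r) / (-Real.log r)) (nhdsWithin 0 (Set.Ioi 0))

open Topology

section Kernel

variable {n : ℕ} {s t r r' : ℝ}

lemma phiKer_nonneg (hr : 0 < r) (x : EuclideanSpace ℝ (Fin n)) : 0 ≤ phiKer n s r x := by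
  unfold phiKer
  split_ifs
  · exact zero_le_one
  · exact le_min zero_le_one (by positivity)

lemma phiKer_le_one (x : EuclideanSpace ℝ (Fin n)) : phiKer n s r x ≤ 1 := by
  unfold phiKer
  split_ifs
  · exact le_rfl
  · exact min_le_left _ _

lemma measurable_phiKer : Measurable (phiKer n s r) := by
  unfold phiKer
  refine Measurable.ite (measurableSet_singleton 0) measurable_const ?_
  fun_prop

lemma rpow_le_phiKer {D : ℝ} (hs : 0 < s) (hr : 0 < r) (hrD : r ≤ D)
    {x : EuclideanSpace ℝ (Fin n)} (hx : ‖x‖ ≤ D) : (r / D) ^ s ≤ phiKer n s r x := by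
  have hD : 0 < D := hr.trans_le hrD
  have h1 : (r / D) ^ s ≤ 1 :=
    Real.rpow_le_one (by positivity) ((div_le_one hD).2 hrD) hs.le
  unfold phiKer
  split_ifs with h
  · exact h1
  · have hx0 : 0 < ‖x‖ := norm_pos_iff.2 h
    exact le_min h1 (by gcongr)

/-- The kernel at a small scale is controlled by the kernel of a larger exponent at another scale. -/
lemma phiKer_le_add (ht : 0 < t) (hr : 0 < r) (hr' : 0 < r')
    (x : EuclideanSpace ℝ (Fin n)) :
    phiKer n s r' x ≤ phiKer n t r x + (r' / r) ^ s * phiKer n t r x ^ (s / t) := by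
  have hnn : 0 ≤ (r' / r) ^ s * phiKer n t r x ^ (s / t) :=
    mul_nonneg (by positivity) (Real.rpow_nonneg (phiKer_nonneg hr x) _)
  rcases lt_or_ge ‖x‖ r with hx | hx
  · have h1 : phiKer n t r x = 1 := by
      unfold phiKer
      split_ifs with h
      · rfl
      · have hx0 : 0 < ‖x‖ := norm_pos_iff.2 h
        exact min_eq_left (Real.one_le_rpow ((one_le_div hx0).2 hx.le) ht.le)
    have := phiKer_le_one (s := s) (r := r') x
    linarith
  · have hx0 : 0 < ‖x‖ := hr.trans_le hx
    have h0 : x ≠ 0 := norm_pos_iff.1 hx0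
    have h1 : phiKer n t r x = (r / ‖x‖) ^ t := by
      rw [phiKer, if_neg h0]
      exact min_eq_right (Real.rpow_le_one (by positivity) ((div_le_one hx0).2 hx) ht.le)
    have h2 : phiKer n s r' x ≤ (r' / ‖x‖) ^ s := by
      rw [phiKer, if_neg h0]
      exact min_le_right _ _
    have h3 : (r' / ‖x‖) ^ s = (r' / r) ^ s * phiKer n t r x ^ (s / t) := by
      rw [h1, ← Real.rpow_mul (by positivity), mul_div_cancel₀ _ ht.ne',
        ← Real.mul_rpow (by positivity) (by positivity)]
      congr 1
      field_simp
    have := phiKer_nonneg (s := t) hr x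
    linarith

variable (μ : Measure (EuclideanSpace ℝ (Fin n))) [IsProbabilityMeasure μ]

lemma integrable_phiKer_sub (hr : 0 < r) :
    Integrable (fun z : EuclideanSpace ℝ (Fin n) × EuclideanSpace ℝ (Fin n) =>
      phiKer n s r (z.1 - z.2)) (μ.prod μ) := by
  refine Integrable.of_bound (C := 1)
    (measurable_phiKer.comp (measurable_fst.sub measurable_snd)).aestronglyMeasurable
    (Eventually.of_forall fun z => ?_)
  rw [Real.norm_of_nonneg (phiKer_nonneg hr _)]
  exact phiKer_le_one _

lemma integral_integral_phiKer (hr : 0 < r) :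
    ∫ x, ∫ y, phiKer n s r (x - y) ∂μ ∂μ = ∫ z, phiKer n s r (z.1 - z.2) ∂(μ.prod μ) :=
  (integral_prod _ (integrable_phiKer_sub μ hr)).symm

lemma energy_le_add (hs : 0 < s) (hst : s ≤ t) (hr : 0 < r) (hr' : 0 < r') :
    ∫ x, ∫ y, phiKer n s r' (x - y) ∂μ ∂μ ≤
      ∫ x, ∫ y, phiKer n t r (x - y) ∂μ ∂μ +
        (r' / r) ^ s * (∫ x, ∫ y, phiKer n t r (x - y) ∂μ ∂μ) ^ (s / t) := by
  have ht : 0 < t := hs.trans_le hst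
  rw [integral_integral_phiKer μ hr, integral_integral_phiKer μ hr']
  have hi := integrable_phiKer_sub (s := t) μ hr
  have hi' : Integrable (fun z : EuclideanSpace ℝ (Fin n) × EuclideanSpace ℝ (Fin n) =>
      phiKer n t r (z.1 - z.2) ^ (s / t)) (μ.prod μ) := by
    refine Integrable.of_bound (C := 1) (((measurable_phiKer.comp
      (measurable_fst.sub measurable_snd)).pow_const _).aestronglyMeasurable)
      (Eventually.of_forall fun z => ?_)
    rw [Real.norm_of_nonneg (Real.rpow_nonneg (phiKer_nonneg hr _) _)]
    exact Real.rpow_le_one (phiKer_nonneg hr _) (phiKer_le_one _) (by positivity)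
  have hJ : ∫ z, phiKer n t r (z.1 - z.2) ^ (s / t) ∂(μ.prod μ) ≤
      (∫ z, phiKer n t r (z.1 - z.2) ∂(μ.prod μ)) ^ (s / t) :=
    (Real.concaveOn_rpow (p := s / t) (by positivity) ((div_le_one ht).2 hst)).le_map_integral
      (Real.continuous_rpow_const (by positivity)).continuousOn isClosed_Ici
      (Eventually.of_forall fun z => phiKer_nonneg hr _) hi hi'
  calc _ ≤ ∫ z, (phiKer n t r (z.1 - z.2) +
        (r' / r) ^ s * phiKer n t r (z.1 - z.2) ^ (s / t)) ∂(μ.prod μ) :=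
        integral_mono (integrable_phiKer_sub μ hr') (hi.add (hi'.const_mul _))
          fun z => phiKer_le_add ht hr hr' _
    _ = ∫ z, phiKer n t r (z.1 - z.2) ∂(μ.prod μ) +
        (r' / r) ^ s * ∫ z, phiKer n t r (z.1 - z.2) ^ (s / t) ∂(μ.prod μ) := by
        rw [integral_add hi (hi'.const_mul _), integral_const_mul]
    _ ≤ _ := by gcongr

end Kernel

/-- The set of energies of probability measures supported on the closure of `E`. -/
def energySet (n : ℕ) (s r : ℝ) (E : Set (EuclideanSpace ℝ (Fin n))) : Set ℝ :=
  {I : ℝ | ∃ μ : Measure (EuclideanSpace ℝ (Fin n)),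
    IsProbabilityMeasure μ ∧ μ (closure E)ᶜ = 0 ∧
      I = ∫ x, ∫ y, phiKer n s r (x - y) ∂μ ∂μ}

/-- The quotient whose lower and upper limits at scale zero are the dimension profiles. -/
noncomputable def profileRatio (n : ℕ) (s : ℝ) (E : Set (EuclideanSpace ℝ (Fin n))) (r : ℝ) : ℝ :=
  Real.log (capacity n s r E) / (-Real.log r)

section Profile

variable {n : ℕ} {s t r : ℝ} {E : Set (EuclideanSpace ℝ (Fin n))}

lemma profileRatio_eq : profileRatio n s E r = Real.log (sInf (energySet n s r E)) / Real.log r := by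
  rw [profileRatio, capacity, Real.log_inv, neg_div_neg_eq]
  rfl

lemma one_mem_energySet (hne : E.Nonempty) : 1 ∈ energySet n s r E := by
  obtain ⟨a, ha⟩ := hne
  refine ⟨Measure.dirac a, inferInstance, ?_, ?_⟩
  · rw [Measure.dirac_apply' _ isClosed_closure.measurableSet.compl]
    simp [subset_closure ha]
  · simp [phiKer]

lemma bddBelow_energySet (hr : 0 < r) : BddBelow (energySet n s r E) := by
  refine ⟨0, ?_⟩
  rintro I ⟨μ, -, -, rfl⟩
  exact integral_nonneg fun x => integral_nonneg fun y => phiKer_nonneg hr _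

lemma exists_rpow_le_sInf_energySet (hne : E.Nonempty) (hE : Bornology.IsBounded E) :
    ∃ D : ℝ, 1 ≤ D ∧ ∀ s r : ℝ, 0 < s → 0 < r → r ≤ D →
      (r / D) ^ s ≤ sInf (energySet n s r E) := by
  obtain ⟨C, hC⟩ := Metric.isBounded_iff.1 hE.closure
  refine ⟨max C 1, le_max_right _ _, fun s r hs hr hrD => ?_⟩
  refine le_csInf ⟨1, one_mem_energySet hne⟩ ?_
  rintro I ⟨μ, hμ, hμE, rfl⟩
  have hae : ∀ᵐ x ∂μ, x ∈ closure E := hμE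
  rw [integral_integral_phiKer μ hr]
  have h1 : ∀ᵐ z ∂(μ.prod μ), z.1 ∈ closure E := Measure.quasiMeasurePreserving_fst.ae hae
  have h2 : ∀ᵐ z ∂(μ.prod μ), z.2 ∈ closure E := Measure.quasiMeasurePreserving_snd.ae hae
  have h := integral_mono_ae (integrable_const ((r / max C 1) ^ s))
    (integrable_phiKer_sub (s := s) μ hr) (by
      filter_upwards [h1, h2] with z hz1 hz2
      refine rpow_le_phiKer hs hr hrD ?_
      rw [← dist_eq_norm]
      exact (hC hz1 hz2).trans (le_max_left _ _))
  simpa using h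

lemma sInf_energySet_pos (hne : E.Nonempty) (hE : Bornology.IsBounded E) (hs : 0 < s)
    (hr : 0 < r) (hr1 : r ≤ 1) : 0 < sInf (energySet n s r E) := by
  obtain ⟨D, hD, h⟩ := exists_rpow_le_sInf_energySet hne hE
  exact lt_of_lt_of_le (by positivity) (h s r hs hr (hr1.trans hD))

lemma eventually_mem_Ioo_zero_one : ∀ᶠ r : ℝ in 𝓝[>] 0, 0 < r ∧ r < 1 :=
  Ioo_mem_nhdsGT zero_lt_one

lemma eventually_profileRatio_nonneg (hne : E.Nonempty) (hE : Bornology.IsBounded E)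
    (hs : 0 < s) : ∀ᶠ r in 𝓝[>] (0 : ℝ), 0 ≤ profileRatio n s E r := by
  filter_upwards [eventually_mem_Ioo_zero_one] with r ⟨hr, hr1⟩
  rw [profileRatio_eq]
  exact div_nonneg_of_nonpos
    (Real.log_nonpos (sInf_energySet_pos hne hE hs hr hr1.le).le
      (csInf_le (bddBelow_energySet hr) (one_mem_energySet hne)))
    (Real.log_nonpos hr.le hr1.le)

lemma tendsto_const_div_log (c : ℝ) :
    Tendsto (fun r : ℝ => c / Real.log r) (𝓝[>] 0) (𝓝 0) :=
  Real.tendsto_log_nhdsGT_zero.const_div_atBot c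

lemma eventually_profileRatio_lt (hne : E.Nonempty) (hE : Bornology.IsBounded E)
    (hs : 0 < s) {v : ℝ} (hv : s < v) : ∀ᶠ r in 𝓝[>] (0 : ℝ), profileRatio n s E r < v := by
  obtain ⟨D, hD, h⟩ := exists_rpow_le_sInf_energySet hne hE
  have ht := (tendsto_const_div_log (s * Real.log D)).const_sub s
  rw [sub_zero] at ht
  filter_upwards [eventually_mem_Ioo_zero_one, ht.eventually_lt_const hv] with r ⟨hr, hr1⟩ hlt
  refine lt_of_le_of_lt ?_ hlt
  have hlog : Real.log r < 0 := Real.log_neg hr hr1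
  have hD0 : 0 < D := by linarith
  have := Real.log_le_log (by positivity) (h s r hs hr (hr1.le.trans hD))
  rw [Real.log_rpow (by positivity), Real.log_div hr.ne' hD0.ne'] at this
  rw [profileRatio_eq, div_le_iff_of_neg hlog, sub_mul, div_mul_cancel₀ _ hlog.ne]
  linarith

lemma sInf_energySet_rpow_le (hs : 0 < s) (hst : s ≤ t) (hr : 0 < r) {u : ℝ}
    (hne : E.Nonempty) (h : sInf (energySet n t r E) < r ^ u) :
    sInf (energySet n s (r ^ (1 + (1 / s - 1 / t) * u)) E) ≤ 2 * r ^ u := by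
  have ht : 0 < t := hs.trans_le hst
  obtain ⟨I, ⟨μ, hμ, hμE, rfl⟩, hlt⟩ := exists_lt_of_csInf_lt ⟨1, one_mem_energySet hne⟩ h
  have hr' : 0 < r ^ (1 + (1 / s - 1 / t) * u) := by positivity
  refine (csInf_le (bddBelow_energySet hr') ⟨μ, hμ, hμE, rfl⟩).trans
    ((energy_le_add μ hs hst hr hr').trans ?_)
  have h0 : 0 ≤ ∫ x, ∫ y, phiKer n t r (x - y) ∂μ ∂μ :=
    integral_nonneg fun x => integral_nonneg fun y => phiKer_nonneg hr _
  have h1 : (r ^ (1 + (1 / s - 1 / t) * u) / r) ^ s * (r ^ u) ^ (s / t) = r ^ u := by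
    rw [Real.rpow_add hr, Real.rpow_one, mul_div_cancel_left₀ _ hr.ne', ← Real.rpow_mul hr.le,
      ← Real.rpow_mul hr.le, ← Real.rpow_add hr]
    congr 1
    field_simp
    ring
  have h2 : (r ^ (1 + (1 / s - 1 / t) * u) / r) ^ s *
      (∫ x, ∫ y, phiKer n t r (x - y) ∂μ ∂μ) ^ (s / t) ≤ r ^ u := by
    rw [← h1]
    gcongr
  linarith

lemma eventually_profileRatio_rpow (hne : E.Nonempty) (hE : Bornology.IsBounded E)
    (hs : 0 < s) (hst : s ≤ t) {u v : ℝ} (hp : 0 < 1 + (1 / s - 1 / t) * u)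
    (hv : v < u / (1 + (1 / s - 1 / t) * u)) :
    ∀ᶠ r in 𝓝[>] (0 : ℝ), u < profileRatio n t E r →
      v ≤ profileRatio n s E (r ^ (1 + (1 / s - 1 / t) * u)) := by
  have ht : 0 < t := hs.trans_le hst
  set p := 1 + (1 / s - 1 / t) * u with hpdef
  have hlim := ((tendsto_const_div_log (Real.log 2)).const_add u).div_const p
  rw [add_zero] at hlim
  filter_upwards [eventually_mem_Ioo_zero_one, hlim.eventually_const_lt hv] with r ⟨hr, hr1⟩ hlt hu
  refine hlt.le.trans ?_
  have hlog : Real.log r < 0 := Real.log_neg hr hr1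
  have hpos := sInf_energySet_pos hne hE ht hr hr1.le
  rw [profileRatio_eq, lt_div_iff_of_neg hlog, ← Real.log_rpow hr,
    Real.log_lt_log_iff hpos (by positivity)] at hu
  have h := sInf_energySet_rpow_le hs hst hr hne hu
  have hrp1 : r ^ p ≤ 1 := Real.rpow_le_one hr.le hr1.le hp.le
  have h2 := Real.log_le_log (sInf_energySet_pos hne hE hs (by positivity) hrp1) h
  rw [Real.log_mul two_ne_zero (by positivity), Real.log_rpow hr] at h2
  rw [profileRatio_eq, Real.log_rpow hr, le_div_iff_of_neg (mul_neg_of_pos_of_neg hp hlog)]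
  refine h2.trans_eq ?_
  have := hlog.ne
  field_simp
  ring

lemma tendsto_rpow_nhdsGT_zero {p : ℝ} (hp : 0 < p) :
    Tendsto (fun r : ℝ => r ^ p) (𝓝[>] 0) (𝓝[>] 0) := by
  refine tendsto_nhdsWithin_iff.2 ⟨?_, ?_⟩
  · have := (Real.continuous_rpow_const hp.le).tendsto 0
    rw [Real.zero_rpow hp.ne'] at this
    exact this.mono_left nhdsWithin_le_nhds
  · filter_upwards [self_mem_nhdsWithin] with r hr
    exact Real.rpow_pos_of_pos hr p

lemma isBoundedUnder_ge_profileRatio (hne : E.Nonempty) (hE : Bornology.IsBounded E)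
    (hs : 0 < s) : IsBoundedUnder (· ≥ ·) (𝓝[>] (0 : ℝ)) (profileRatio n s E) :=
  ⟨0, eventually_map.2 (eventually_profileRatio_nonneg hne hE hs)⟩

lemma isBoundedUnder_le_profileRatio (hne : E.Nonempty) (hE : Bornology.IsBounded E)
    (hs : 0 < s) : IsBoundedUnder (· ≤ ·) (𝓝[>] (0 : ℝ)) (profileRatio n s E) :=
  ⟨s + 1, eventually_map.2
    ((eventually_profileRatio_lt hne hE hs (lt_add_one s)).mono fun _ h => h.le)⟩

lemma lowerProfile_nonneg (hne : E.Nonempty) (hE : Bornology.IsBounded E) (hs : 0 < s) :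
    0 ≤ lowerProfile n s E :=
  le_liminf_of_le (isBoundedUnder_le_profileRatio hne hE hs).isCoboundedUnder_ge
    (eventually_profileRatio_nonneg hne hE hs)

lemma lowerProfile_le_upperProfile (hne : E.Nonempty) (hE : Bornology.IsBounded E) (hs : 0 < s) :
    lowerProfile n s E ≤ upperProfile n s E :=
  liminf_le_limsup (isBoundedUnder_le_profileRatio hne hE hs)
    (isBoundedUnder_ge_profileRatio hne hE hs)

lemma upperProfile_le (hne : E.Nonempty) (hE : Bornology.IsBounded E) (hs : 0 < s) :
    upperProfile n s E ≤ s :=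
  le_of_forall_gt_imp_ge_of_dense fun _ hv =>
    limsup_le_of_le (isBoundedUnder_ge_profileRatio hne hE hs).isCoboundedUnder_le
      ((eventually_profileRatio_lt hne hE hs hv).mono fun _ h => h.le)

lemma div_le_lowerProfile (hne : E.Nonempty) (hE : Bornology.IsBounded E)
    (hs : 0 < s) (hst : s ≤ t) {u : ℝ} (hp : 0 < 1 + (1 / s - 1 / t) * u)
    (hu : u < lowerProfile n t E) :
    u / (1 + (1 / s - 1 / t) * u) ≤ lowerProfile n s E := by
  refine le_of_forall_lt_imp_le_of_dense fun v hv => ?_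
  have h1 := eventually_lt_of_lt_liminf hu (isBoundedUnder_ge_profileRatio hne hE (hs.trans_le hst))
  have h2 : ∀ᶠ r in 𝓝[>] (0 : ℝ),
      v ≤ profileRatio n s E (r ^ (1 + (1 / s - 1 / t) * u)) := by
    filter_upwards [eventually_profileRatio_rpow hne hE hs hst hp hv, h1] with r h h'
    exact h h'
  refine le_liminf_of_le (isBoundedUnder_le_profileRatio hne hE hs).isCoboundedUnder_ge ?_
  filter_upwards [(tendsto_rpow_nhdsGT_zero (inv_pos.2 hp)).eventually h2, self_mem_nhdsWithin]
    with r hr hr0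
  rwa [Real.rpow_inv_rpow (le_of_lt hr0) hp.ne'] at hr

lemma div_le_upperProfile (hne : E.Nonempty) (hE : Bornology.IsBounded E)
    (hs : 0 < s) (hst : s ≤ t) {u : ℝ} (hp : 0 < 1 + (1 / s - 1 / t) * u)
    (hu : u < upperProfile n t E) :
    u / (1 + (1 / s - 1 / t) * u) ≤ upperProfile n s E := by
  refine le_of_forall_lt_imp_le_of_dense fun v hv => ?_
  have h1 := frequently_lt_of_lt_limsup
    (isBoundedUnder_ge_profileRatio hne hE (hs.trans_le hst)).isCoboundedUnder_le hu
  have h2 : ∃ᶠ r in 𝓝[>] (0 : ℝ),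
      v ≤ profileRatio n s E (r ^ (1 + (1 / s - 1 / t) * u)) :=
    (h1.and_eventually (eventually_profileRatio_rpow hne hE hs hst hp hv)).mono
      fun r h => h.2 h.1
  exact le_limsup_of_frequently_le ((tendsto_rpow_nhdsGT_zero hp).frequently h2)
    (isBoundedUnder_le_profileRatio hne hE hs)

end Profile

lemma sub_le_and_le_of_div_le {s t a b : ℝ} (hs : 0 < s) (hst : s ≤ t) (ha0 : 0 ≤ a) (has : a ≤ s)
    (hb0 : 0 ≤ b) (hbt : b ≤ t)
    (h : ∀ u, 0 < 1 + (1 / s - 1 / t) * u → u < b → u / (1 + (1 / s - 1 / t) * u) ≤ a) :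
    b - a ≤ a * b / (s * t) * (t - s) ∧ a * b / (s * t) * (t - s) ≤ t - s := by
  have ht : 0 < t := hs.trans_le hst
  have hc : 0 ≤ 1 / s - 1 / t := sub_nonneg.2 (one_div_le_one_div_of_le hs hst)
  have heq : a * b / (s * t) * (t - s) = a * ((1 / s - 1 / t) * b) := by
    field_simp
  refine ⟨?_, ?_⟩
  · rw [heq, sub_le_iff_le_add]
    refine le_of_forall_lt_imp_le_of_dense fun u hu => ?_
    rcases le_or_gt u 0 with hu0 | hu0
    · exact hu0.trans (by positivity)
    · have hp : 0 < 1 + (1 / s - 1 / t) * u := by positivity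
      have h1 := (div_le_iff₀ hp).1 (h u hp hu)
      have h2 : a * ((1 / s - 1 / t) * u) ≤ a * ((1 / s - 1 / t) * b) := by gcongr
      linarith
  · refine mul_le_of_le_one_left (sub_nonneg.2 hst) ((div_le_one (by positivity)).2 ?_)
    gcongr

theorem stmt_18 (n : ℕ) (hn : 1 ≤ n)
    (E : Set (EuclideanSpace ℝ (Fin n))) (hne : E.Nonempty) (hE : Bornology.IsBounded E)
    (s t : ℝ) (hs : 0 < s) (hst : s ≤ t) :
    (0 < lowerProfile n s E →
      lowerProfile n t E - lowerProfile n s E ≤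
          lowerProfile n s E * lowerProfile n t E / (s * t) * (t - s) ∧
        lowerProfile n s E * lowerProfile n t E / (s * t) * (t - s) ≤ t - s) ∧
    (0 < upperProfile n s E →
      upperProfile n t E - upperProfile n s E ≤
          upperProfile n s E * upperProfile n t E / (s * t) * (t - s) ∧
        upperProfile n s E * upperProfile n t E / (s * t) * (t - s) ≤ t - s) := by
  have ht : 0 < t := hs.trans_le hst
  have hls := lowerProfile_nonneg hne hE hs
  have hlt := lowerProfile_nonneg hne hE ht
  have hlus := lowerProfile_le_upperProfile hne hE hs
  have hlut := lowerProfile_le_upperProfile hne hE ht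
  have hus := upperProfile_le hne hE hs
  have hut := upperProfile_le hne hE ht
  exact ⟨fun _ => sub_le_and_le_of_div_le hs hst hls (hlus.trans hus) hlt (hlut.trans hut)
      fun _ hp hu => div_le_lowerProfile hne hE hs hst hp hu,
    fun _ => sub_le_and_le_of_div_le hs hst (hls.trans hlus) hus (hlt.trans hlut) hut
      fun _ hp hu => div_le_upperProfile hne hE hs hst hp hu⟩
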